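/- Let Γ=(P,L,I) be a rank-2 incidence geometry and λ ≥ 1. Suppose there exists an orientation of all edges of the multigraph I_λ(Γ) and a function peb : P ⊔ L → ℕ such that: (i) peb(p) + outdeg(p) = k₁ for every point p ∈ P and peb(ℓ) + outdeg(ℓ) = k₂ for every line ℓ ∈ L; (ii) for all nonempty subsets A ⊆ P and B ⊆ L, writing W = A ∪ B, Σ_{v∈W} peb(v) + out(W) ≥ l; and (iii) Σ_{v∈P⊔L} peb(v) = l. Then Γ is (λ,k₁,k₂,l)-tight. -/

import Mathlib

open Finset

variable {α β : Type*} [DecidableEq α] [DecidableEq β]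

/-- The source of the edge `e = ((p, ℓ), j)` of the multigraph `I_λ(Γ)` under the
orientation `σ`: the point `p` if `σ e = true`, and the line `ℓ` otherwise. -/
def src (σ : (α × β) × ℕ → Bool) (e : (α × β) × ℕ) : α ⊕ β :=
  if σ e then Sum.inl e.1.1 else Sum.inr e.1.2

/-- The target of the edge `e = ((p, ℓ), j)` under the orientation `σ`:
the endpoint which is not the source. -/
def tgt (σ : (α × β) × ℕ → Bool) (e : (α × β) × ℕ) : α ⊕ β :=
  if σ e then Sum.inr e.1.2 else Sum.inl e.1.1

/-- The out-degree of a vertex `v`: the number of oriented edges of `D` with source `v`. -/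
def outdeg (D : Finset ((α × β) × ℕ)) (σ : (α × β) × ℕ → Bool) (v : α ⊕ β) : ℕ :=
  (D.filter fun e => src σ e = v).card

/-- `span(W)`: the number of oriented edges of `D` with both source and target in `W`. -/
def spanE (D : Finset ((α × β) × ℕ)) (σ : (α × β) × ℕ → Bool)
    (W : Finset (α ⊕ β)) : ℕ :=
  (D.filter fun e => src σ e ∈ W ∧ tgt σ e ∈ W).card

/-- `out(W)`: the number of oriented edges of `D` with source in `W` and target outside `W`. -/
def outE (D : Finset ((α × β) × ℕ)) (σ : (α × β) × ℕ → Bool)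
    (W : Finset (α ⊕ β)) : ℕ :=
  (D.filter fun e => src σ e ∈ W ∧ tgt σ e ∉ W).card

/-- A rank-2 incidence geometry with incidence set `I` is `(lam, k₁, k₂, l)`-sparse if
every nonempty subset `I'` of `I` satisfies
`lam * |I'| ≤ k₁ * |P(I')| + k₂ * |L(I')| - l`, where `P(I') × L(I')` is the support. -/
def IsSparse (lam k₁ k₂ l : ℕ) (I : Finset (α × β)) : Prop :=
  ∀ I' ⊆ I, I'.Nonempty →
    (lam : ℤ) * I'.card ≤
      (k₁ : ℤ) * (I'.image Prod.fst).card + (k₂ : ℤ) * (I'.image Prod.snd).card - l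

/-- A rank-2 incidence geometry `Γ = (P, L, I)` is `(lam, k₁, k₂, l)`-tight if it is sparse and
`lam * |I| = k₁ * |P| + k₂ * |L| - l`. -/
def IsTight (lam k₁ k₂ l : ℕ) (P : Finset α) (L : Finset β) (I : Finset (α × β)) : Prop :=
  I ⊆ P ×ˢ L ∧ IsSparse lam k₁ k₂ l I ∧
    (lam : ℤ) * I.card = (k₁ : ℤ) * P.card + (k₂ : ℤ) * L.card - l

theorem sum_outdeg (D : Finset ((α × β) × ℕ)) (σ : (α × β) × ℕ → Bool)
    (W : Finset (α ⊕ β)) : ∑ v ∈ W, outdeg D σ v = spanE D σ W + outE D σ W := by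
  have h : ∑ v ∈ W, outdeg D σ v = (D.filter fun e => src σ e ∈ W).card := by
    rw [Finset.card_eq_sum_card_fiberwise (f := src σ) (t := W) (by intro e he; simp_all)]
    refine Finset.sum_congr rfl fun v hv => ?_
    rw [outdeg, Finset.filter_filter]
    congr 1
    ext e
    simp only [Finset.mem_filter]
    grind
  rw [h, spanE, outE, ← Finset.card_filter_add_card_filter_not (fun e => tgt σ e ∈ W),
    Finset.filter_filter, Finset.filter_filter]

/-- An edge both of whose endpoints lie in `A ∪ B` is exactly one whose incidence lies in
`A ×ˢ B`. -/
theorem src_mem_and_tgt_mem_iff (σ : (α × β) × ℕ → Bool) (A : Finset α) (B : Finset β)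
    (e : (α × β) × ℕ) :
    src σ e ∈ A.image Sum.inl ∪ B.image Sum.inr ∧ tgt σ e ∈ A.image Sum.inl ∪ B.image Sum.inr ↔
      e.1 ∈ A ×ˢ B := by
  cases h : σ e <;> simp [src, tgt, h, and_comm]

theorem spanE_prod_range (I : Finset (α × β)) (lam : ℕ) (σ : (α × β) × ℕ → Bool)
    (A : Finset α) (B : Finset β) :
    spanE (I ×ˢ Finset.range lam) σ (A.image Sum.inl ∪ B.image Sum.inr) =
      lam * (I.filter (· ∈ A ×ˢ B)).card := by
  simp only [spanE, src_mem_and_tgt_mem_iff]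
  rw [mul_comm, ← Finset.card_range lam, ← Finset.card_product, Finset.card_range]
  congr 1
  ext e
  simp only [Finset.mem_filter, Finset.mem_product]
  tauto

theorem sum_image_inl_union_image_inr (A : Finset α) (B : Finset β) (f : α ⊕ β → ℕ) :
    ∑ v ∈ A.image Sum.inl ∪ B.image Sum.inr, f v =
      ∑ p ∈ A, f (Sum.inl p) + ∑ x ∈ B, f (Sum.inr x) := by
  rw [Finset.sum_union (by simp [Finset.disjoint_left]),
    Finset.sum_image (by simp), Finset.sum_image (by simp)]

/-- The pebbles on `A ∪ B`, the edges spanned by `A ∪ B` and the edges leaving `A ∪ B` add up to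
`k₁ * |A| + k₂ * |B|`. -/
theorem sum_peb_add_span_add_out {lam k₁ k₂ : ℕ} {I : Finset (α × β)}
    {σ : (α × β) × ℕ → Bool} {peb : α ⊕ β → ℕ} {A : Finset α} {B : Finset β}
    (hA : ∀ p ∈ A, peb (Sum.inl p) + outdeg (I ×ˢ Finset.range lam) σ (Sum.inl p) = k₁)
    (hB : ∀ x ∈ B, peb (Sum.inr x) + outdeg (I ×ˢ Finset.range lam) σ (Sum.inr x) = k₂) :
    (∑ v ∈ A.image Sum.inl ∪ B.image Sum.inr, peb v) + lam * (I.filter (· ∈ A ×ˢ B)).card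
      + outE (I ×ˢ Finset.range lam) σ (A.image Sum.inl ∪ B.image Sum.inr) =
      k₁ * A.card + k₂ * B.card := by
  rw [add_assoc, ← spanE_prod_range I lam σ, ← sum_outdeg, ← Finset.sum_add_distrib,
    sum_image_inl_union_image_inr, Finset.sum_congr rfl hA, Finset.sum_congr rfl hB]
  simp [mul_comm]

/-- If all edges of `I_λ(Γ)` are oriented, there is a pebble assignment satisfying the
pebble-game invariants, and exactly `l` pebbles remain, then `Γ` is `(λ, k₁, k₂, l)`-tight. -/
theorem tight_of_orientation (lam k₁ k₂ l : ℕ) (hlam : 1 ≤ lam)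
    (P : Finset α) (L : Finset β) (I : Finset (α × β)) (hI : I ⊆ P ×ˢ L)
    (σ : (α × β) × ℕ → Bool) (peb : α ⊕ β → ℕ)
    (hpebP : ∀ p ∈ P, peb (Sum.inl p) + outdeg (I ×ˢ Finset.range lam) σ (Sum.inl p) = k₁)
    (hpebL : ∀ x ∈ L, peb (Sum.inr x) + outdeg (I ×ˢ Finset.range lam) σ (Sum.inr x) = k₂)
    (hout : ∀ A ⊆ P, ∀ B ⊆ L, A.Nonempty → B.Nonempty →
      l ≤ (∑ v ∈ A.image Sum.inl ∪ B.image Sum.inr, peb v)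
          + outE (I ×ˢ Finset.range lam) σ (A.image Sum.inl ∪ B.image Sum.inr))
    (htotal : (∑ v ∈ P.image Sum.inl ∪ L.image Sum.inr, peb v) = l) :
    IsTight lam k₁ k₂ l P L I := by
  refine ⟨hI, fun I' hI' hne => ?_, ?_⟩
  · have hA : I'.image Prod.fst ⊆ P := by
      intro p hp
      obtain ⟨i, hi, rfl⟩ := Finset.mem_image.1 hp
      exact (Finset.mem_product.1 (hI (hI' hi))).1
    have hB : I'.image Prod.snd ⊆ L := by
      intro x hx
      obtain ⟨i, hi, rfl⟩ := Finset.mem_image.1 hx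
      exact (Finset.mem_product.1 (hI (hI' hi))).2
    have hcount := sum_peb_add_span_add_out (fun p hp => hpebP p (hA hp))
      (fun x hx => hpebL x (hB hx))
    have hl := hout _ hA _ hB (hne.image _) (hne.image _)
    have hle : lam * I'.card ≤
        lam * (I.filter (· ∈ I'.image Prod.fst ×ˢ I'.image Prod.snd)).card :=
      Nat.mul_le_mul_left _ <| Finset.card_le_card fun i hi => Finset.mem_filter.2
        ⟨hI' hi, Finset.mem_product.2
          ⟨Finset.mem_image_of_mem _ hi, Finset.mem_image_of_mem _ hi⟩⟩
    zify at hcount hl hle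
    linarith
  · have hcount := sum_peb_add_span_add_out hpebP hpebL
    have hzero : outE (I ×ˢ Finset.range lam) σ (P.image Sum.inl ∪ L.image Sum.inr) = 0 := by
      refine Finset.card_eq_zero.2 (Finset.filter_eq_empty_iff.2 fun e he h => h.2 ?_)
      exact ((src_mem_and_tgt_mem_iff σ P L e).2 (hI (Finset.mem_product.1 he).1)).2
    rw [htotal, hzero, Finset.filter_true_of_mem fun i hi => hI hi] at hcount
    zify at hcount
    linarith
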